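/- arXiv:2303.10028 — 10 statements merged into one kernel-verified Lean document; each statement's English description precedes it below -/
import Mathlib

section
/- For every nonempty finite set Q of points in the Euclidean plane ℝ², there exists a spanning tree T of the complete graph K_Q (with each edge pq weighted by the Euclidean distance |pq|) such that T is a minimum spanning tree of K_Q and every vertex of T has degree at most 5. In particular, T is also a minimum bottleneck spanning tree of K_Q with maximum degree at most 5. -/
open scoped NNReal

noncomputable section

/-- The Euclidean plane. -/
abbrev Pl : Type := EuclideanSpace ℝ (Fin 2)

/-- Euclidean length of an edge of the complete graph on the point set `Q`. -/
def edgeLen (Q : Finset Pl) : Sym2 {x // x ∈ Q} → ℝ≥0 :=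
  Sym2.lift ⟨fun x y => nndist (x : Pl) (y : Pl), fun _ _ => nndist_comm _ _⟩

/-- Total Euclidean edge length of a spanning subgraph `T` of the complete graph `K_Q`. -/
def totalWeight (Q : Finset Pl) (T : SimpleGraph {x // x ∈ Q}) : ℝ≥0 :=
  ∑ e ∈ (Set.toFinite T.edgeSet).toFinset, edgeLen Q e

/-- Maximum Euclidean edge length (bottleneck) of a spanning subgraph `T` of `K_Q`. -/
def bottleneck (Q : Finset Pl) (T : SimpleGraph {x // x ∈ Q}) : ℝ≥0 :=
  (Set.toFinite T.edgeSet).toFinset.sup (edgeLen Q)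

namespace SimpleGraph

variable {V : Type*}

/-- The tree exchange property: deleting an edge `s(a, b)` of a tree and adding an edge that
reconnects the two resulting components gives a tree. -/
theorem IsTree.exchange {T : SimpleGraph V} (hT : T.IsTree) {a b c d : V}
    (hc : (T.deleteEdges {s(a, b)}).Reachable a c)
    (hd : ¬ (T.deleteEdges {s(a, b)}).Reachable a d) :
    (T.deleteEdges {s(a, b)} ⊔ edge c d).IsTree := by
  set F := T.deleteEdges {s(a, b)} with hF
  have hcd : c ≠ d := by rintro rfl; exact hd hc
  have hcomp : ∀ x, F.Reachable a x ∨ F.Reachable b x := by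
    intro x
    by_contra hx
    obtain ⟨p⟩ := hT.connected.preconnected a x
    obtain ⟨e, -, h1, h2⟩ :=
      p.exists_boundary_dart {y | F.Reachable a y ∨ F.Reachable b y} (Or.inl .rfl) hx
    simp only [Set.mem_ofPred_eq] at h1 h2
    by_cases he : s(e.fst, e.snd) = s(a, b)
    · rcases Sym2.eq_iff.1 he with ⟨-, h⟩ | ⟨-, h⟩
      · exact h2 (Or.inr (h ▸ .rfl))
      · exact h2 (Or.inl (h ▸ .rfl))
    · have hadj : F.Adj e.fst e.snd := by
        rw [hF, deleteEdges_adj]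
        exact ⟨e.adj, he⟩
      exact h2 (h1.imp (·.trans hadj.reachable) (·.trans hadj.reachable))
  have hle : F ≤ F ⊔ edge c d := le_sup_left
  have hac : (F ⊔ edge c d).Reachable a b := by
    have hbd : F.Reachable b d := (hcomp d).resolve_left hd
    have hadj : (F ⊔ edge c d).Adj c d := by
      simp [sup_adj, edge_adj, hcd]
    exact ((hc.mono hle).trans hadj.reachable).trans (hbd.symm.mono hle)
  have hall : ∀ x, (F ⊔ edge c d).Reachable a x := fun x =>
    (hcomp x).elim (·.mono hle) (fun h => hac.trans (h.mono hle))
  have : Nonempty V := ⟨a⟩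
  exact ⟨⟨fun x y => (hall x).symm.trans (hall y)⟩,
    (hT.isAcyclic.anti (deleteEdges_le _)).sup_edge_of_not_reachable
    fun h => hd (hc.trans h)⟩

theorem sum_edgeSet_exchange [Finite V] {M : Type*} [AddCommMonoid M] (g : Sym2 V → M)
    {T : SimpleGraph V} {a b c d : V} (hab : T.Adj a b) (hcd : c ≠ d)
    (hn : ¬ (T.deleteEdges {s(a, b)}).Adj c d) :
    (∑ e ∈ (Set.toFinite (T.deleteEdges {s(a, b)} ⊔ edge c d).edgeSet).toFinset, g e) + g s(a, b) =
      (∑ e ∈ (Set.toFinite T.edgeSet).toFinset, g e) + g s(c, d) := by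
  classical
  set F := T.deleteEdges {s(a, b)} with hF
  have h1 : (Set.toFinite (F ⊔ edge c d).edgeSet).toFinset =
      insert s(c, d) (Set.toFinite F.edgeSet).toFinset := by
    ext e
    rw [Set.Finite.mem_toFinset, edgeSet_sup, edgeSet_edge_of_ne hcd]
    simp
  have h2 : (Set.toFinite T.edgeSet).toFinset =
      insert s(a, b) (Set.toFinite F.edgeSet).toFinset := by
    ext e
    by_cases he : e = s(a, b)
    · simp [he, hab]
    · simp [hF, he]
  rw [h1, h2, Finset.sum_insert (by simpa using hn), Finset.sum_insert (by simp [hF])]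
  abel

theorem IsTree.not_reachable_deleteEdges {T : SimpleGraph V} (hT : T.IsTree) {a b : V}
    (hab : T.Adj a b) : ¬ (T.deleteEdges {s(a, b)}).Reachable a b :=
  isBridge_iff.1 (isAcyclic_iff_forall_adj_isBridge.1 hT.isAcyclic hab)

/-- An edge of a spanning tree can be exchanged for some edge of any other spanning tree. -/
theorem IsTree.exists_exchange {T T' : SimpleGraph V} (hT : T.IsTree) (hT' : T'.IsTree)
    {a b : V} (hab : T.Adj a b) :
    ∃ c d, T'.Adj c d ∧ (T.deleteEdges {s(a, b)}).Reachable a c ∧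
      ¬ (T.deleteEdges {s(a, b)}).Reachable a d := by
  obtain ⟨p⟩ := hT'.connected.preconnected a b
  obtain ⟨e, -, h1, h2⟩ := p.exists_boundary_dart
    {y | (T.deleteEdges {s(a, b)}).Reachable a y} .rfl (hT.not_reachable_deleteEdges hab)
  exact ⟨e.fst, e.snd, e.adj, h1, h2⟩

end SimpleGraph

open Real in
/-- A set of angles with pairwise circular distances at least `π / 3`, in which every angle at
distance exactly `π / 3` from another has nonnegative cosine, has at most five elements. -/
theorem card_le_five_of_cos_sub_le (A : Finset ℝ) (hA : ∀ a ∈ A, -π < a ∧ a ≤ π)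
    (h : ∀ a ∈ A, ∀ b ∈ A, a ≠ b → cos (a - b) ≤ 1 / 2 ∧ (cos (a - b) = 1 / 2 → 0 ≤ cos a)) :
    A.card ≤ 5 := by
  by_contra hcard
  obtain ⟨B, hBA, hB⟩ := Finset.exists_subset_card_eq (show 6 ≤ A.card by omega)
  set f := B.orderEmbOfFin hB
  have hf : ∀ i, f i ∈ A := fun i => hBA (B.orderEmbOfFin_mem hB i)
  have gap : ∀ i j, i < j → π / 3 ≤ f j - f i ∧ f j - f i ≤ 5 * π / 3 := by
    intro i j hij
    have hlt : f i < f j := f.strictMono hij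
    have hcos := (h _ (hf j) _ (hf i) hlt.ne').1
    have hi := hA _ (hf i)
    have hj := hA _ (hf j)
    refine ⟨?_, ?_⟩ <;> by_contra hlt'
    · have := cos_lt_cos_of_nonneg_of_le_pi (x := f j - f i) (y := π / 3)
        (by linarith) (by linarith [pi_pos]) (by linarith)
      rw [cos_pi_div_three] at this
      linarith
    · have := cos_lt_cos_of_nonneg_of_le_pi (x := 2 * π - (f j - f i)) (y := π / 3)
        (by linarith) (by linarith [pi_pos]) (by linarith)
      rw [cos_pi_div_three, cos_two_pi_sub] at this
      linarith
  have g01 := gap 0 1 (by decide)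
  have g12 := gap 1 2 (by decide)
  have g23 := gap 2 3 (by decide)
  have g34 := gap 3 4 (by decide)
  have g45 := gap 4 5 (by decide)
  have g05 := gap 0 5 (by decide)
  have nonneg : ∀ i j, i ≠ j → |f i - f j| = π / 3 → 0 ≤ cos (f i) := by
    intro i j hij hd
    refine (h _ (hf i) _ (hf j) (f.injective.ne hij)).2 ?_
    rw [← cos_abs, hd, cos_pi_div_three]
  have e1 : f 1 = f 0 + π / 3 := by linarith
  have e3 : f 3 = f 0 + π := by linarith
  have e4 : f 4 = f 1 + π := by linarith
  have hp : 0 ≤ π / 3 := by positivity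
  have n0 := nonneg 0 1 (by decide) (by
    rw [show f 0 - f 1 = -(π / 3) by linarith, abs_neg, abs_of_nonneg hp])
  have n1 := nonneg 1 0 (by decide) (by
    rw [show f 1 - f 0 = π / 3 by linarith, abs_of_nonneg hp])
  have n3 := nonneg 3 2 (by decide) (by
    rw [show f 3 - f 2 = π / 3 by linarith, abs_of_nonneg hp])
  have n4 := nonneg 4 3 (by decide) (by
    rw [show f 4 - f 3 = π / 3 by linarith, abs_of_nonneg hp])
  rw [e3, cos_add_pi] at n3
  rw [e4, cos_add_pi] at n4
  have c0 : cos (f 0) = 0 := by linarith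
  have c1 : cos (f 1) = 0 := by linarith
  rw [e1, cos_add, c0, sin_pi_div_three] at c1
  have s0 : sin (f 0) = 0 := by
    have h3 : (0 : ℝ) < √3 := by positivity
    by_contra hs
    exact mul_ne_zero hs (by positivity : √3 / 2 ≠ 0) (by linarith)
  have := sin_sq_add_cos_sq (f 0)
  rw [s0, c0] at this
  norm_num at this

theorem Complex.norm_sub_sq_eq_cos_arg (a b : ℂ) :
    ‖a - b‖ ^ 2 = ‖a‖ ^ 2 + ‖b‖ ^ 2 - 2 * (‖a‖ * ‖b‖ * Real.cos (a.arg - b.arg)) := by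
  have ha := Complex.norm_mul_cos_arg a
  have ha' := Complex.norm_mul_sin_arg a
  have hb := Complex.norm_mul_cos_arg b
  have hb' := Complex.norm_mul_sin_arg b
  have key : ‖a‖ * ‖b‖ * Real.cos (a.arg - b.arg) = a.re * b.re + a.im * b.im := by
    rw [Real.cos_sub, ← ha, ← hb, ← ha', ← hb']
    ring
  rw [key]
  simp only [Complex.sq_norm, Complex.normSq_apply, Complex.sub_re, Complex.sub_im]
  ring

/-- A set of nonzero complex numbers in which every two elements form with `0` a triangle whose
longest side is opposite to `0`, and in which the elements of equilateral such triangles have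
nonnegative real part, has at most five elements. -/
theorem Complex.card_le_five_of_norm_le_norm_sub (S : Finset ℂ) (h0 : ∀ a ∈ S, a ≠ 0)
    (h : ∀ a ∈ S, ∀ b ∈ S, a ≠ b → ‖a‖ ≤ ‖a - b‖ ∧ (‖a‖ = ‖a - b‖ → 0 ≤ b.re)) :
    S.card ≤ 5 := by
  have key : ∀ a ∈ S, ∀ b ∈ S, a ≠ b → Real.cos (a.arg - b.arg) ≤ 1 / 2 ∧
      (Real.cos (a.arg - b.arg) = 1 / 2 → 0 ≤ Real.cos a.arg) := by
    intro a ha b hb hab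
    have h1 := h a ha b hb hab
    have h2 := h b hb a ha hab.symm
    rw [norm_sub_rev b a] at h2
    have pa : 0 < ‖a‖ := norm_pos_iff.2 (h0 a ha)
    have pb : 0 < ‖b‖ := norm_pos_iff.2 (h0 b hb)
    have hn := Complex.norm_sub_sq_eq_cos_arg a b
    have sa : ‖a‖ ^ 2 ≤ ‖a - b‖ ^ 2 := by gcongr; exact h1.1
    have sb : ‖b‖ ^ 2 ≤ ‖a - b‖ ^ 2 := by gcongr; exact h2.1
    refine ⟨?_, fun hc => ?_⟩
    · by_contra! hc
      have hlt : ‖a‖ * ‖b‖ < 2 * (‖a‖ * ‖b‖ * Real.cos (a.arg - b.arg)) := by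
        nlinarith [mul_pos pa pb]
      rcases le_total ‖a‖ ‖b‖ with hle | hle <;> nlinarith
    · rw [hc] at hn
      have hEq : ‖a‖ = ‖b‖ := by
        rcases le_total ‖a‖ ‖b‖ with hle | hle <;> nlinarith
      have hre := h2.2 (by
        rw [hEq] at hn
        exact (sq_eq_sq₀ pb.le (norm_nonneg _)).1 (by linarith))
      rw [← Complex.norm_mul_cos_arg a] at hre
      exact nonneg_of_mul_nonneg_right hre pa
  have hinj : Set.InjOn Complex.arg S := by
    intro a ha b hb heq
    by_contra hab
    have := (key a ha b hb hab).1
    rw [heq, sub_self, Real.cos_zero] at this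
    norm_num at this
  rw [← Finset.card_image_of_injOn hinj]
  apply card_le_five_of_cos_sub_le
  · simp only [Finset.mem_image, forall_exists_index, and_imp]
    rintro _ a - rfl
    exact ⟨Complex.neg_pi_lt_arg a, Complex.arg_le_pi a⟩
  · simp only [Finset.mem_image, forall_exists_index, and_imp]
    rintro _ a ha rfl _ b hb rfl hab
    exact key a ha b hb (fun hh => hab (hh ▸ rfl))

/-- A planar point set whose elements are pairwise at least as far from each other as from `v`, such
that ties only occur to the right of `v`, has at most five elements. -/
theorem ncard_le_five_of_dist_le (v : Pl) (N : Set Pl) (hN : N.Finite) (hv : v ∉ N)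
    (h : ∀ u ∈ N, ∀ w ∈ N, u ≠ w →
      dist u v ≤ dist u w ∧ (dist u v = dist u w → v 0 ≤ w 0)) :
    N.ncard ≤ 5 := by
  classical
  obtain ⟨e, he⟩ : ∃ e : Pl ≃ₗᵢ[ℝ] ℂ, ∀ p, (e p).re = p 0 :=
    ⟨Complex.orthonormalBasisOneI.repr.symm, fun p => by simp⟩
  let φ : Pl → ℂ := fun p => e (p - v)
  have hφ : Function.Injective φ := fun p q hpq => by simpa [φ] using hpq
  have hnorm : ∀ p, ‖φ p‖ = dist p v := fun p => by
    simp only [φ, LinearIsometryEquiv.norm_map, dist_eq_norm]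
  have hsub : ∀ p q, ‖φ p - φ q‖ = dist p q := fun p q => by
    simp only [φ, ← map_sub, LinearIsometryEquiv.norm_map, dist_eq_norm, sub_sub_sub_cancel_right]
  have hre : ∀ p, (φ p).re = p 0 - v 0 := fun p => by simp [φ, he]
  rw [Set.ncard_eq_toFinset_card N hN, ← Finset.card_image_of_injective _ hφ]
  apply Complex.card_le_five_of_norm_le_norm_sub
  · simp only [Finset.mem_image, Set.Finite.mem_toFinset, forall_exists_index, and_imp]
    rintro _ u hu rfl
    rw [← norm_pos_iff, hnorm, dist_pos]
    rintro rfl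
    exact hv hu
  · simp only [Finset.mem_image, Set.Finite.mem_toFinset, forall_exists_index, and_imp]
    rintro _ u hu rfl _ w hw rfl huw
    rw [hnorm, hsub, hre, sub_nonneg]
    exact h u hu w hw (fun hh => huw (hh ▸ rfl))

/-- Sum of the first coordinates of the endpoints of an edge. -/
def edgeAbscissa (Q : Finset Pl) : Sym2 {x // x ∈ Q} → ℝ :=
  Sym2.lift ⟨fun x y => (x : Pl) 0 + (y : Pl) 0, fun _ _ => add_comm _ _⟩

theorem totalWeight_exchange {Q : Finset Pl} {T : SimpleGraph {x // x ∈ Q}}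
    {a b c d : {x // x ∈ Q}} (hab : T.Adj a b)
    (hc : (T.deleteEdges {s(a, b)}).Reachable a c)
    (hd : ¬ (T.deleteEdges {s(a, b)}).Reachable a d) :
    totalWeight Q (T.deleteEdges {s(a, b)} ⊔ SimpleGraph.edge c d) + edgeLen Q s(a, b) =
      totalWeight Q T + edgeLen Q s(c, d) :=
  SimpleGraph.sum_edgeSet_exchange (edgeLen Q) hab (fun h => hd (h ▸ hc))
    fun h => hd (hc.trans h.reachable)

/-- For every nonempty finite point set `Q` in the plane there is a minimum spanning tree of the
complete graph `K_Q` (edges weighted by Euclidean distance) of maximum degree at most 5; in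
particular it is also a minimum bottleneck spanning tree of maximum degree at most 5. -/
theorem stmt1 (Q : Finset Pl) (hQ : Q.Nonempty) :
    ∃ T : SimpleGraph {x // x ∈ Q}, T.IsTree ∧
      (∀ T' : SimpleGraph {x // x ∈ Q}, T'.IsTree → totalWeight Q T ≤ totalWeight Q T') ∧
      (∀ v, (T.neighborSet v).ncard ≤ 5) ∧
      (∀ T' : SimpleGraph {x // x ∈ Q}, T'.IsTree → bottleneck Q T ≤ bottleneck Q T') := by
  classical
  have : Nonempty {x // x ∈ Q} := hQ.to_subtype
  obtain ⟨T₀, -, hT₀⟩ := (SimpleGraph.connected_top (V := {x // x ∈ Q})).exists_isTree_le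
  obtain ⟨T₁, hT₁, hmin₁⟩ := Set.exists_min_image {T : SimpleGraph {x // x ∈ Q} | T.IsTree}
    (totalWeight Q) (Set.toFinite _) ⟨T₀, hT₀⟩
  let abscissa : SimpleGraph {x // x ∈ Q} → ℝ := fun T =>
    ∑ e ∈ (Set.toFinite T.edgeSet).toFinset, edgeAbscissa Q e
  obtain ⟨T, ⟨hT, hmin⟩, hmin₂⟩ := Set.exists_min_image
    {T : SimpleGraph {x // x ∈ Q} | T.IsTree ∧ ∀ T', T'.IsTree → totalWeight Q T ≤ totalWeight Q T'}
    abscissa (Set.toFinite _) ⟨T₁, hT₁, hmin₁⟩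
  refine ⟨T, hT, hmin, fun v => ?_, fun T' hT' => ?_⟩
  · rw [← Set.ncard_image_of_injective _ Subtype.val_injective]
    apply ncard_le_five_of_dist_le v _ (Set.toFinite _)
    · rintro ⟨u, hu, huv⟩
      exact T.ne_of_adj hu (Subtype.ext huv.symm)
    rintro _ ⟨u, hu, rfl⟩ _ ⟨w, hw, rfl⟩ huw
    rw [SimpleGraph.mem_neighborSet] at hu hw
    have huw' : u ≠ w := fun h => huw (h ▸ rfl)
    have hc : (T.deleteEdges {s(v, u)}).Reachable v w := by
      refine SimpleGraph.Adj.reachable ?_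
      rw [SimpleGraph.deleteEdges_adj]
      refine ⟨hw, ?_⟩
      simp only [Set.mem_singleton_iff, Sym2.congr_right]
      exact huw'.symm
    have hd := hT.not_reachable_deleteEdges hu
    have htree := hT.exchange hc hd
    have hW := totalWeight_exchange hu hc hd
    have hA : abscissa _ + _ = abscissa _ + _ :=
      SimpleGraph.sum_edgeSet_exchange (edgeAbscissa Q) hu huw'.symm
        fun h => hd (hc.trans h.reachable)
    have huv : (edgeLen Q s(v, u) : ℝ) = dist (u : Pl) v := by simp [edgeLen, dist_comm]
    have hwu : (edgeLen Q s(w, u) : ℝ) = dist (u : Pl) w := by simp [edgeLen, dist_comm]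
    rw [← huv, ← hwu, NNReal.coe_le_coe, NNReal.coe_inj]
    refine ⟨?_, fun heq => ?_⟩
    · exact le_of_add_le_add_left (hW ▸ add_le_add_left (hmin _ htree) (edgeLen Q s(v, u)))
    · rw [heq] at hW
      have := hmin₂ _ ⟨htree, fun T' hT' => (add_right_cancel hW).trans_le (hmin T' hT')⟩
      simp only [edgeAbscissa, Sym2.lift_mk] at hA
      linarith
  · refine Finset.sup_le fun e he => ?_
    induction e with | _ a b
    have hab : T.Adj a b := by simpa using he
    obtain ⟨c, d, hcd, hc, hd⟩ := hT.exists_exchange hT' hab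
    have hW := totalWeight_exchange hab hc hd
    have hle : edgeLen Q s(a, b) ≤ edgeLen Q s(c, d) :=
      le_of_add_le_add_left
        (hW ▸ add_le_add_left (hmin _ (hT.exchange hc hd)) (edgeLen Q s(a, b)))
    exact hle.trans (Finset.le_sup (f := edgeLen Q) (by simpa using hcd))

end
end

section
/- Let T be a tree on a finite vertex set A ∪ B with A and B disjoint and |A| = k, such that every vertex of T has degree at most 5. Suppose B is partitioned into ℓ nonempty classes such that no edge of T joins two vertices of B lying in distinct classes (every edge of T either has an endpoint in A or joins two vertices of B in the same class). Then ℓ ≤ 4k + 1. -/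
/-- A connected graph, mapped onto `W` so that every edge is either collapsed or has an endpoint in
the finite set `A`, whose vertices have degree at most `d`, forces `|W| ≤ d * |A| + 1`. -/
theorem SimpleGraph.Connected.card_le_mul_card_add_one_of_surjective {V W : Type*} [Finite V]
    {G : SimpleGraph V} (hG : G.Connected) (A : Finset V) (d : ℕ)
    (hdeg : ∀ v ∈ A, (G.neighborSet v).ncard ≤ d) (f : V → W) (hf : Function.Surjective f)
    (hedge : ∀ u v, u ∉ A → v ∉ A → G.Adj u v → f u = f v) :
    Nat.card W ≤ d * A.card + 1 := by
  classical
  have : Finite W := Finite.of_surjective f hf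
  let H : SimpleGraph W :=
    { Adj := fun x y => x ≠ y ∧ ∃ u v, G.Adj u v ∧ f u = x ∧ f v = y
      symm := ⟨fun x y ⟨hne, u, v, h, hu, hv⟩ => ⟨hne.symm, v, u, h.symm, hv, hu⟩⟩
      loopless := ⟨fun x h => h.1 rfl⟩ }
  have hwalk : ∀ {u v : V}, G.Walk u v → H.Reachable (f u) (f v) := by
    intro u v p
    induction p with
    | nil => exact SimpleGraph.Reachable.refl _
    | @cons u v w h p ih =>
      by_cases he : f u = f v
      · rwa [he]
      · exact (SimpleGraph.Adj.reachable (G := H) ⟨he, u, v, h, rfl, rfl⟩).trans ih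
  have hH : H.Connected := by
    have := hG.nonempty.map f
    refine SimpleGraph.Connected.mk fun x y => ?_
    obtain ⟨u, rfl⟩ := hf x
    obtain ⟨v, rfl⟩ := hf y
    obtain ⟨p⟩ := hG.preconnected u v
    exact hwalk p
  have hsub : H.edgeSet ⊆ ⋃ a ∈ A, (fun v => s(f a, f v)) '' G.neighborSet a := by
    intro e
    induction e with
    | h x y =>
      rintro ⟨hne, u, v, h, rfl, rfl⟩
      simp only [Set.mem_iUnion, Set.mem_image, SimpleGraph.mem_neighborSet]
      by_cases hu : u ∈ A
      · exact ⟨u, hu, v, h, rfl⟩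
      by_cases hv : v ∈ A
      · exact ⟨v, hv, u, h.symm, Sym2.eq_swap⟩
      exact absurd (hedge u v hu hv h) hne
  have hcard : H.edgeSet.ncard ≤ d * A.card :=
    calc H.edgeSet.ncard
        ≤ (⋃ a ∈ A, (fun v => s(f a, f v)) '' G.neighborSet a).ncard :=
          Set.ncard_le_ncard hsub (Set.toFinite _)
      _ ≤ ∑ a ∈ A, ((fun v => s(f a, f v)) '' G.neighborSet a).ncard :=
          Finset.set_ncard_biUnion_le _ _
      _ ≤ ∑ a ∈ A, d :=
          Finset.sum_le_sum fun a ha => (Set.ncard_image_le (Set.toFinite _)).trans (hdeg a ha)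
      _ = d * A.card := by rw [Finset.sum_const, smul_eq_mul, mul_comm]
  have hvert := hH.card_vert_le_card_edgeSet_add_one
  rw [Nat.card_coe_set_eq] at hvert
  omega

/-- Let `T` be a tree on a finite vertex set whose vertices outside a `k`-element set `A`
form the set `B`, with every vertex of degree at most 5.  If `B` is partitioned into `ℓ`
nonempty classes (given by a class map `c` that is surjective on `B`) such that no edge of `T`
joins two vertices of `B` lying in distinct classes, then `ℓ ≤ 4k + 1`. -/
theorem stmt4 {V : Type*} [Fintype V] (T : SimpleGraph V) (hT : T.IsTree)
    (A : Finset V) (k : ℕ) (hk : A.card = k)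
    (hdeg : ∀ v, (T.neighborSet v).ncard ≤ 5)
    (ℓ : ℕ) (c : {v : V // v ∉ A} → Fin ℓ)
    (hsurj : Function.Surjective c)
    (hedge : ∀ u v : {v : V // v ∉ A}, T.Adj u.1 v.1 → c u = c v) :
    ℓ ≤ 4 * k + 1 := by
  classical
  let f : V → A ⊕ Fin ℓ := fun v => if h : v ∈ A then Sum.inl ⟨v, h⟩ else Sum.inr (c ⟨v, h⟩)
  have hf : Function.Surjective f := by
    rintro (⟨a, ha⟩ | i)
    · exact ⟨a, by simp [f, ha]⟩
    · obtain ⟨⟨v, hv⟩, rfl⟩ := hsurj i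
      exact ⟨v, by simp [f, hv]⟩
  have key := hT.connected.card_le_mul_card_add_one_of_surjective A 5 (fun v _ => hdeg v) f hf
    fun u v hu hv h => by simp [f, hu, hv, hedge ⟨u, hu⟩ ⟨v, hv⟩ h]
  simp only [Nat.card_eq_fintype_card, Fintype.card_sum, Fintype.card_coe, Fintype.card_fin] at key
  omega
end

section
/- Let 𝒮 = {s_1,…,s_k} be closed line segments in ℝ², let 𝒞 = {C_1,…,C_ℓ} be pairwise disjoint nonempty finite sets of points in ℝ², let δ ≥ 0, and let τ be a topology tree on the nodes 𝒮 ∪ 𝒞. Then τ is δ-realizable if and only if every significant topology subtree of τ is δ-realizable. -/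
noncomputable section

/-- A topology tree on the nodes `𝒮 ∪ 𝒞` (segments indexed by `Fin k`, components by
`Fin ℓ`): a tree in which every segment node has degree at most 5 and no two component
nodes are adjacent. -/
def IsTopologyTree {k ℓ : ℕ} (τ : SimpleGraph (Fin k ⊕ Fin ℓ)) : Prop :=
  τ.IsTree ∧ (∀ i : Fin k, (τ.neighborSet (Sum.inl i)).ncard ≤ 5) ∧
    ∀ i j : Fin ℓ, ¬ τ.Adj (Sum.inr i) (Sum.inr j)

/-- A topology tree `τ` is `δ`-realizable. -/
def Realizable {k ℓ : ℕ} (s : Fin k → Set Pl) (C : Fin ℓ → Set Pl) (δ : ℝ)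
    (τ : SimpleGraph (Fin k ⊕ Fin ℓ)) : Prop :=
  ∃ p : Fin k → Pl, (∀ i, p i ∈ s i) ∧
    (∀ i j : Fin k, τ.Adj (Sum.inl i) (Sum.inl j) → dist (p i) (p j) ≤ δ) ∧
    (∀ (i : Fin ℓ) (j : Fin k), τ.Adj (Sum.inr i) (Sum.inl j) →
      ∃ q ∈ C i, dist q (p j) ≤ δ)

/-- `δ`-realizability of the significant topology subtree of `τ` determined by a set `W` of
segment nodes (together with all component nodes adjacent to them in `τ`). -/
def RealizableOn {k ℓ : ℕ} (s : Fin k → Set Pl) (C : Fin ℓ → Set Pl) (δ : ℝ)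
    (τ : SimpleGraph (Fin k ⊕ Fin ℓ)) (W : Set (Fin k)) : Prop :=
  ∃ p : Fin k → Pl,
    (∀ i ∈ W, p i ∈ s i) ∧
    (∀ i ∈ W, ∀ j ∈ W, τ.Adj (Sum.inl i) (Sum.inl j) → dist (p i) (p j) ≤ δ) ∧
    (∀ j ∈ W, ∀ i : Fin ℓ, τ.Adj (Sum.inr i) (Sum.inl j) → ∃ q ∈ C i, dist q (p j) ≤ δ)

/-- A topology tree is `δ`-realizable iff each of its significant topology subtrees is
`δ`-realizable.  The significant topology subtrees correspond exactly to the connected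
components of the graph induced by `τ` on the segment nodes (each such component, together
with the adjacent component nodes of `𝒞`, forms one significant topology subtree). -/
theorem stmt7 (k ℓ : ℕ) (s : Fin k → Set Pl)
    (hseg : ∀ i, ∃ a b : Pl, s i = segment ℝ a b)
    (C : Fin ℓ → Set Pl)
    (hCfin : ∀ i, (C i).Finite) (hCne : ∀ i, (C i).Nonempty)
    (hCdisj : ∀ i j, i ≠ j → Disjoint (C i) (C j))
    (δ : ℝ) (hδ : 0 ≤ δ)
    (τ : SimpleGraph (Fin k ⊕ Fin ℓ)) (hτ : IsTopologyTree τ) :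
    Realizable s C δ τ ↔
      ∀ W : (τ.comap Sum.inl).ConnectedComponent, RealizableOn s C δ τ W.supp := by
  constructor
  · rintro ⟨p, hmem, hadj, hC⟩ W
    exact ⟨p, fun i _ => hmem i, fun i _ j _ => hadj i j, fun j _ i => hC i j⟩
  · intro h
    choose p hmem hadj hC using h
    let comp := (τ.comap Sum.inl).connectedComponentMk
    refine ⟨fun i => p (comp i) i, fun i => hmem (comp i) i rfl, fun i j hij => ?_,
      fun i j hij => hC (comp j) j rfl i hij⟩
    have hcomp : comp j = comp i :=
      (SimpleGraph.ConnectedComponent.connectedComponentMk_eq_of_adj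
        (SimpleGraph.comap_adj.mpr hij)).symm
    simpa only [hcomp] using hadj (comp i) i rfl j hcomp hij

end
end

section
/- Let τ' be a significant topology subtree rooted at a segment node s_r, let δ ≥ 0, and let s_i be an internal segment node of τ' whose children in τ' are the segment nodes s_1,…,s_t and the component nodes C_1,…,C_u. Then X_i(δ) = s_i ∩ (⋂_{ℓ=1}^{t} (X_ℓ(δ) ⊕ D(0,δ))) ∩ (⋂_{ℓ=1}^{u} (C_ℓ ⊕ D(0,δ))), where A ⊕ B = {a + b : a ∈ A, b ∈ B} is the Minkowski sum and D(0,δ) is the closed disk of radius δ centered at the origin in ℝ². -/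
open scoped Pointwise

noncomputable section

/-- In the tree `τ` rooted at `r`, the node `v` lies in the subtree hanging from the node `i`:
every walk from `v` to the root passes through `i`. -/
def InSubtree {V : Type*} (τ : SimpleGraph V) (r i v : V) : Prop :=
  ∀ w : τ.Walk v r, i ∈ w.support

/-- The set `X_i(δ)` for the significant topology subtree `τ` rooted at the segment node `r`:
points `x ∈ s i` such that one can choose a point `q m ∈ C m` for each component node of the
subtree rooted at `s i`, and a point `p j ∈ s j` for each segment node of that subtree, with
`p i = x`, such that the two endpoints of each edge of the subtree rooted at `s i` carry
points at distance at most `δ`. -/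
def Xset {K L : ℕ} (τ : SimpleGraph (Fin K ⊕ Fin L)) (r : Fin K)
    (s : Fin K → Set Pl) (C : Fin L → Set Pl) (δ : ℝ) (i : Fin K) : Set Pl :=
  {x | x ∈ s i ∧ ∃ (p : Fin K → Pl) (q : Fin L → Pl),
    p i = x ∧
    (∀ j, InSubtree τ (Sum.inl r) (Sum.inl i) (Sum.inl j) → p j ∈ s j) ∧
    (∀ m, InSubtree τ (Sum.inl r) (Sum.inl i) (Sum.inr m) → q m ∈ C m) ∧
    (∀ j j', InSubtree τ (Sum.inl r) (Sum.inl i) (Sum.inl j) →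
      InSubtree τ (Sum.inl r) (Sum.inl i) (Sum.inl j') →
      τ.Adj (Sum.inl j) (Sum.inl j') → dist (p j) (p j') ≤ δ) ∧
    (∀ j m, InSubtree τ (Sum.inl r) (Sum.inl i) (Sum.inl j) →
      InSubtree τ (Sum.inl r) (Sum.inl i) (Sum.inr m) →
      τ.Adj (Sum.inl j) (Sum.inr m) → dist (p j) (q m) ≤ δ)}

namespace InSubtree

variable {V : Type*} {τ : SimpleGraph V} {r i c d v w : V}

theorem refl (τ : SimpleGraph V) (r i : V) : InSubtree τ r i i :=
  fun w => w.start_mem_support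

theorem trans (hc : InSubtree τ r i c) (hv : InSubtree τ r c v) : InSubtree τ r i v := by
  classical
  intro w
  exact w.support_dropUntil_subset_support (hv w) (hc _)

/-- Subtree membership passes along an edge whose upper end is not the root of the subtree. -/
theorem of_adj (hv : InSubtree τ r c v) (hvw : τ.Adj v w) (hne : c ≠ v) :
    InSubtree τ r c w := by
  intro q
  have h := hv (.cons hvw q)
  rw [SimpleGraph.Walk.support_cons, List.mem_cons] at h
  exact h.resolve_left hne

/-- A node does not lie in the subtree of one of its proper descendants. -/
theorem not_symm (hτ : τ.Connected) (hc : InSubtree τ r i c) (hne : c ≠ i) :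
    ¬ InSubtree τ r c i := by
  classical
  intro hi
  obtain ⟨w, hw⟩ := hτ.exists_isPath c r
  have hmem := hi (w.dropUntil i (hc w))
  have hnodup := hw.support_nodup
  rw [← w.take_spec (hc w), SimpleGraph.Walk.support_append] at hnodup
  have htail : c ∈ (w.dropUntil i (hc w)).support.tail := by
    rw [SimpleGraph.Walk.mem_support_iff] at hmem
    exact hmem.resolve_left hne
  exact (List.nodup_append.1 hnodup).2.2 c (SimpleGraph.Walk.start_mem_support _) c htail rfl

/-- Within the subtree of a child `c` of `i`, only `c` itself is adjacent to `i`. -/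
theorem eq_of_adj (hτ : τ.Connected) (hc : InSubtree τ r i c) (hne : c ≠ i)
    (hv : InSubtree τ r c v) (hvi : τ.Adj v i) : c = v := by
  by_contra h
  exact hc.not_symm hτ hne (hv.of_adj hvi h)

/-- Two nodes with a common descendant are comparable. -/
theorem total (hτ : τ.Connected) (hc : InSubtree τ r c v) (hd : InSubtree τ r d v) :
    InSubtree τ r c d ∨ InSubtree τ r d c := by
  classical
  by_contra! h
  simp only [InSubtree, not_forall] at h
  obtain ⟨⟨p, hp⟩, q, hq⟩ := h
  have hne : c ≠ d := by
    rintro rfl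
    exact hp p.start_mem_support
  obtain ⟨w, hw⟩ := hτ.exists_isPath v r
  have hdc : d ∈ (w.takeUntil c (hc w)).support := by
    have := hd ((w.takeUntil c (hc w)).append q)
    rw [SimpleGraph.Walk.mem_support_append_iff] at this
    exact this.resolve_right hq
  have hcd : c ∈ ((w.takeUntil c (hc w)).takeUntil d hdc).support := by
    have := hc (((w.takeUntil c (hc w)).takeUntil d hdc).append p)
    rw [SimpleGraph.Walk.mem_support_append_iff] at this
    exact this.resolve_right hp
  exact SimpleGraph.Walk.endpoint_notMem_support_takeUntil (hw.takeUntil (hc w)) hdc hne hcd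

/-- The subtrees of distinct children of `i` are disjoint. -/
theorem child_unique (hτ : τ.Connected) (hic : τ.Adj i c) (hc : InSubtree τ r i c)
    (hid : τ.Adj i d) (hd : InSubtree τ r i d) (hcv : InSubtree τ r c v)
    (hdv : InSubtree τ r d v) : c = d := by
  rcases hcv.total hτ hdv with h | h
  · exact hc.eq_of_adj hτ hic.ne' h hid.symm
  · exact (hd.eq_of_adj hτ hid.ne' h hic.symm).symm

/-- Every proper descendant of `i` is a descendant of a child of `i`. -/
theorem exists_child (hτ : τ.IsTree) (hv : InSubtree τ r i v) (hne : v ≠ i) :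
    ∃ c, τ.Adj i c ∧ InSubtree τ r i c ∧ InSubtree τ r c v := by
  classical
  obtain ⟨w, hw⟩ := hτ.connected.exists_isPath v r
  let p := w.takeUntil i (hv w)
  have hp : p.IsPath := hw.takeUntil (hv w)
  have hnil : ¬ p.Nil := SimpleGraph.Walk.not_nil_of_ne hne
  refine ⟨p.penultimate, (SimpleGraph.Walk.adj_penultimate hnil).symm, fun q => ?_, fun q => ?_⟩
  · have hmem := hv (p.dropLast.append q)
    rw [SimpleGraph.Walk.mem_support_append_iff] at hmem
    refine hmem.resolve_left fun h => ?_
    have hnodup := hp.support_nodup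
    rw [← SimpleGraph.Walk.support_dropLast_concat hnil] at hnodup
    exact (List.nodup_append.1 hnodup).2.2 i h i (List.mem_singleton_self i) rfl
  · have hq := q.bypass_isPath.takeUntil (hv q.bypass)
    have heq : p = q.bypass.takeUntil i (hv q.bypass) :=
      congrArg Subtype.val ((hτ.isAcyclic.subsingleton_path v i).elim ⟨p, hp⟩ ⟨_, hq⟩)
    apply q.support_bypass_subset_support
    apply q.bypass.support_takeUntil_subset_support (hv q.bypass)
    rw [← heq]
    exact p.getVert_mem_support _

/-- Every edge of the subtree rooted at `i` that avoids `i` lies in the subtree of a child. -/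
theorem exists_child_of_adj (hτ : τ.IsTree) (hv : InSubtree τ r i v) (hw : InSubtree τ r i w)
    (hvi : v ≠ i) (hwi : w ≠ i) (hvw : τ.Adj v w) :
    ∃ c, τ.Adj i c ∧ InSubtree τ r i c ∧ InSubtree τ r c v ∧ InSubtree τ r c w := by
  obtain ⟨c, hic, hc, hcv⟩ := hv.exists_child hτ hvi
  obtain ⟨d, hid, hd, hdw⟩ := hw.exists_child hτ hwi
  by_cases hne_cv : c = v
  · by_cases hne_dw : d = w
    · subst hne_cv hne_dw
      have hp : (SimpleGraph.Walk.cons hic (.cons hvw .nil)).IsPath := by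
        simp [hic.ne, hid.ne, hvw.ne]
      exact (hvw.ne (hτ.isAcyclic.eq_snd_of_adj_start hp hid (by simp)).symm).elim
    · exact ⟨d, hid, hd, hdw.of_adj hvw.symm hne_dw, hdw⟩
  · exact ⟨c, hic, hc, hcv, hcv.of_adj hvw hne_cv⟩

/-- The subtree of a leaf `c` adjacent to `i` in the subtree of `i` is `{c}`. -/
theorem eq_of_leaf (hτ : τ.IsTree) (hic : τ.Adj i c) (hc : InSubtree τ r i c)
    (hleaf : (τ.neighborSet c).ncard = 1) (hv : InSubtree τ r c v) : v = c := by
  by_contra hne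
  obtain ⟨d, hcd, hd, -⟩ := hv.exists_child hτ hne
  obtain ⟨a, ha⟩ := Set.ncard_eq_one.1 hleaf
  have hda : d ∈ τ.neighborSet c := hcd
  have hia : i ∈ τ.neighborSet c := hic.symm
  rw [ha, Set.mem_singleton_iff] at hda hia
  rw [hda, ← hia] at hd
  exact hc.not_symm hτ.connected hic.ne' hd

end InSubtree

theorem mem_add_closedBall_zero_iff {E : Type*} [SeminormedAddCommGroup E] {A : Set E} {δ : ℝ}
    {x : E} : x ∈ A + Metric.closedBall (0 : E) δ ↔ ∃ y ∈ A, dist x y ≤ δ := by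
  constructor
  · rintro ⟨y, hy, z, hz, rfl⟩
    exact ⟨y, hy, by simpa using hz⟩
  · rintro ⟨y, hy, h⟩
    exact ⟨y, hy, x - y, by simpa [dist_eq_norm] using h, by simp⟩

/-- A family of functions can be glued along pairwise disjoint domains. -/
theorem exists_glue {ι α β : Type*} [Nonempty β] (S : ι → α → Prop) (f : ι → α → β)
    (hS : ∀ a b x, S a x → S b x → a = b) : ∃ g : α → β, ∀ a x, S a x → g x = f a x := by
  classical
  refine ⟨fun x => if h : ∃ a, S a x then f h.choose x else Classical.arbitrary β, ?_⟩
  intro a x hx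
  have h : ∃ a, S a x := ⟨a, hx⟩
  simp only [dif_pos h, hS _ _ x h.choose_spec hx]

/-- Recursive description of `X_i(δ)`: if the children of the internal segment node `s i` in
the significant topology subtree `τ` (rooted at `s r`) are the segment nodes `s (sc a)`,
`a : Fin t`, and the component nodes `C (cc a)`, `a : Fin u`, then `X_i(δ)` equals the
intersection of `s i` with the `δ`-neighborhoods (Minkowski sums with the closed disk
`D(0,δ)`) of the sets `X_{sc a}(δ)` and of the components `C (cc a)`. -/
theorem stmt8 (K L : ℕ) (τ : SimpleGraph (Fin K ⊕ Fin L)) (hτ : τ.IsTree)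
    (hdeg : ∀ i : Fin K, (τ.neighborSet (Sum.inl i)).ncard ≤ 5)
    (hleaf : ∀ m : Fin L, (τ.neighborSet (Sum.inr m)).ncard = 1)
    (hCC : ∀ m m' : Fin L, ¬ τ.Adj (Sum.inr m) (Sum.inr m'))
    (s : Fin K → Set Pl) (hseg : ∀ i, ∃ a b : Pl, s i = segment ℝ a b)
    (C : Fin L → Set Pl) (hCfin : ∀ m, (C m).Finite) (hCne : ∀ m, (C m).Nonempty)
    (r : Fin K) (δ : ℝ) (hδ : 0 ≤ δ)
    (i : Fin K) (t u : ℕ)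
    (sc : Fin t → Fin K) (hsc : Function.Injective sc)
    (cc : Fin u → Fin L) (hcc : Function.Injective cc)
    (hchild : ∀ v : Fin K ⊕ Fin L,
      (τ.Adj (Sum.inl i) v ∧ InSubtree τ (Sum.inl r) (Sum.inl i) v) ↔
        ((∃ a, v = Sum.inl (sc a)) ∨ (∃ a, v = Sum.inr (cc a))))
    (hinternal : 0 < t + u) :
    Xset τ r s C δ i =
      s i ∩ (⋂ a : Fin t, (Xset τ r s C δ (sc a) + Metric.closedBall (0 : Pl) δ)) ∩
        ⋂ a : Fin u, (C (cc a) + Metric.closedBall (0 : Pl) δ) := by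
  have hcon := hτ.connected
  have hS (a : Fin t) := (hchild (Sum.inl (sc a))).2 (.inl ⟨a, rfl⟩)
  have hT (b : Fin u) := (hchild (Sum.inr (cc b))).2 (.inr ⟨b, rfl⟩)
  ext x
  simp only [Set.mem_inter_iff, Set.mem_iInter, mem_add_closedBall_zero_iff]
  constructor
  · rintro ⟨hx, p, q, rfl, hp, hq, hpp, hpq⟩
    have hi := InSubtree.refl τ (Sum.inl r) (Sum.inl i)
    refine ⟨⟨hx, fun a => ?_⟩, fun b => ?_⟩
    · obtain ⟨hadj, hsub⟩ := hS a
      refine ⟨p (sc a), ⟨hp _ hsub, p, q, rfl, fun j hj => hp j (hsub.trans hj),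
        fun m hm => hq m (hsub.trans hm),
        fun j j' hj hj' => hpp j j' (hsub.trans hj) (hsub.trans hj'),
        fun j m hj hm => hpq j m (hsub.trans hj) (hsub.trans hm)⟩, hpp _ _ hi hsub hadj⟩
    · obtain ⟨hadj, hsub⟩ := hT b
      exact ⟨q (cc b), hq _ hsub, hpq _ _ hi hsub hadj⟩
  · rintro ⟨⟨hx, hX⟩, hC⟩
    choose y hy hxy using hX
    choose hys P Q hPy hP hQ hPP hPQ using hy
    choose z hz hxz using hC
    obtain ⟨p₀, hp₀⟩ := exists_glue
      (fun (a : Fin t) j => InSubtree τ (Sum.inl r) (Sum.inl (sc a)) (Sum.inl j)) P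
      (fun a b j ha hb => hsc (Sum.inl_injective (InSubtree.child_unique hcon
        (hS a).1 (hS a).2 (hS b).1 (hS b).2 ha hb)))
    obtain ⟨p, hpi, hp⟩ : ∃ p : Fin K → Pl, p i = x ∧ ∀ a j,
        InSubtree τ (Sum.inl r) (Sum.inl (sc a)) (Sum.inl j) → p j = P a j := by
      refine ⟨Function.update p₀ i x, by simp, fun a j h => ?_⟩
      have hji : j ≠ i := by
        rintro rfl
        exact (hS a).2.not_symm hcon (hS a).1.ne' h
      rw [Function.update_of_ne hji, hp₀ a j h]
    obtain ⟨q, hq⟩ := exists_glue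
      (Sum.elim (fun (a : Fin t) m => InSubtree τ (Sum.inl r) (Sum.inl (sc a)) (Sum.inr m))
        (fun (b : Fin u) m => m = cc b))
      (Sum.elim Q fun b _ => z b) (by
        rintro (a | b) (a' | b') m h h' <;> simp only [Sum.elim_inl, Sum.elim_inr] at h h'
        · exact congrArg Sum.inl (hsc (Sum.inl_injective (InSubtree.child_unique hcon
            (hS a).1 (hS a).2 (hS a').1 (hS a').2 h h')))
        · subst h'
          have := (hS a).2.eq_of_adj hcon (hS a).1.ne' h (hT b').1.symm
          simp at this
        · subst h
          have := (hS a').2.eq_of_adj hcon (hS a').1.ne' h' (hT b).1.symm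
          simp at this
        · exact congrArg Sum.inr (hcc (h.symm.trans h')))
    have hqa (a m) (h : InSubtree τ (Sum.inl r) (Sum.inl (sc a)) (Sum.inr m)) :
        q m = Q a m := hq (Sum.inl a) m h
    have hqb (b) : q (cc b) = z b := hq (Sum.inr b) _ rfl
    have hpa (a) : p (sc a) = y a := (hp a _ (InSubtree.refl τ _ _)).trans (hPy a)
    have key (v) (hv : InSubtree τ (Sum.inl r) (Sum.inl i) v) (hvi : v ≠ Sum.inl i) :
        (∃ a, InSubtree τ (Sum.inl r) (Sum.inl (sc a)) v) ∨ ∃ b, v = Sum.inr (cc b) := by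
      obtain ⟨c, hic, hc, hcv⟩ := hv.exists_child hτ hvi
      rcases (hchild c).1 ⟨hic, hc⟩ with ⟨a, rfl⟩ | ⟨b, rfl⟩
      · exact .inl ⟨a, hcv⟩
      · exact .inr ⟨b, InSubtree.eq_of_leaf hτ hic hc (hleaf _) hcv⟩
    have keyAdj (v w) (hv : InSubtree τ (Sum.inl r) (Sum.inl i) v)
        (hw : InSubtree τ (Sum.inl r) (Sum.inl i) w) (hvi : v ≠ Sum.inl i)
        (hwi : w ≠ Sum.inl i) (hvw : τ.Adj v w) :
        ∃ a, InSubtree τ (Sum.inl r) (Sum.inl (sc a)) v ∧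
          InSubtree τ (Sum.inl r) (Sum.inl (sc a)) w := by
      obtain ⟨c, hic, hc, hcv, hcw⟩ := hv.exists_child_of_adj hτ hw hvi hwi hvw
      rcases (hchild c).1 ⟨hic, hc⟩ with ⟨a, rfl⟩ | ⟨b, rfl⟩
      · exact ⟨a, hcv, hcw⟩
      · exact (hvw.ne ((InSubtree.eq_of_leaf hτ hic hc (hleaf _) hcv).trans
          (InSubtree.eq_of_leaf hτ hic hc (hleaf _) hcw).symm)).elim
    have hdist (j) (hj : InSubtree τ (Sum.inl r) (Sum.inl i) (Sum.inl j))
        (hadj : τ.Adj (Sum.inl i) (Sum.inl j)) : dist x (p j) ≤ δ := by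
      rcases (hchild _).1 ⟨hadj, hj⟩ with ⟨a, ha⟩ | ⟨b, hb⟩
      · rw [Sum.inl_injective ha, hpa]
        exact hxy a
      · cases hb
    refine ⟨hx, p, q, hpi, fun j hj => ?_, fun m hm => ?_, fun j j' hj hj' hadj => ?_,
      fun j m hj hm hadj => ?_⟩
    · by_cases hji : j = i
      · rw [hji, hpi]
        exact hx
      · rcases key _ hj (by simpa using hji) with ⟨a, ha⟩ | ⟨b, hb⟩
        · rw [hp a j ha]
          exact hP a j ha
        · cases hb
    · rcases key _ hm (by simp) with ⟨a, ha⟩ | ⟨b, hb⟩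
      · rw [hqa a m ha]
        exact hQ a m ha
      · rw [Sum.inr_injective hb, hqb]
        exact hz b
    · by_cases hji : j = i
      · subst hji
        rw [hpi]
        exact hdist j' hj' hadj
      by_cases hji' : j' = i
      · subst hji'
        rw [hpi, dist_comm]
        exact hdist j hj hadj.symm
      obtain ⟨a, ha, ha'⟩ := keyAdj _ _ hj hj' (by simpa using hji) (by simpa using hji') hadj
      rw [hp a j ha, hp a j' ha']
      exact hPP a j j' ha ha' hadj
    · by_cases hji : j = i
      · subst hji
        rcases (hchild _).1 ⟨hadj, hm⟩ with ⟨a, ha⟩ | ⟨b, hb⟩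
        · cases ha
        · rw [hpi, Sum.inr_injective hb, hqb]
          exact hxz b
      obtain ⟨a, ha, ha'⟩ := keyAdj _ _ hj hm (by simpa using hji) (by simp) hadj
      rw [hp a j ha, hqa a m ha']
      exact hPQ a j m ha ha' hadj

end
end

section
/- Let k ≥ 1 and 0 ≤ ℓ ≤ 4k + 1, let 𝒮 be a set of k labeled nodes and 𝒞 a set of ℓ labeled nodes disjoint from 𝒮. Then the number of trees on the vertex set 𝒮 ∪ 𝒞 in which every node of 𝒮 has degree at most 5 and no two nodes of 𝒞 are adjacent is at most (5k + 1)^{5k − 1}. -/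
/-- A tree with a marked vertex `r` is recovered from a function sending every other vertex to its
parent, that is, to its neighbour closer to `r`. -/
theorem SimpleGraph.IsTree.exists_parent {V : Type*} {τ : SimpleGraph V} (hτ : τ.IsTree) (r : V) :
    ∃ f : V → V, f r = r ∧ (∀ v, v ≠ r → τ.Adj v (f v)) ∧
      τ = SimpleGraph.fromRel (fun u v => f u = v) := by
  classical
  have closer : ∀ v, ∃ w, v ≠ r → τ.Adj v w ∧ τ.dist w r < τ.dist v r := by
    intro v
    by_cases hv : v = r
    · exact ⟨r, fun h => absurd hv h⟩
    · obtain ⟨p, hp⟩ := hτ.connected.exists_walk_length_eq_dist v r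
      cases p with
      | nil => exact absurd rfl hv
      | @cons _ w _ h q =>
        refine ⟨w, fun _ => ⟨h, ?_⟩⟩
        have := SimpleGraph.dist_le q
        rw [SimpleGraph.Walk.length_cons] at hp
        omega
  choose g hg using closer
  have hadj : ∀ v, v ≠ r → τ.Adj v (Function.update g r r v) := fun v hv => by
    rw [Function.update_of_ne hv]
    exact (hg v hv).1
  refine ⟨Function.update g r r, by simp, hadj, ?_⟩
  set H := SimpleGraph.fromRel (fun u v => Function.update g r r u = v) with hH
  have hle : H ≤ τ := by
    intro u v huv
    rw [hH, SimpleGraph.fromRel_adj] at huv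
    obtain ⟨hne, h | h⟩ := huv
    · have hu : u ≠ r := by
        rintro rfl
        simp at h
        exact hne h
      exact h ▸ hadj u hu
    · have hv : v ≠ r := by
        rintro rfl
        simp at h
        exact hne h.symm
      exact (h ▸ hadj v hv).symm
  have hreach : ∀ n, ∀ v, τ.dist v r = n → H.Reachable v r := by
    intro n
    induction n using Nat.strong_induction_on with
    | _ n ih =>
      intro v hv
      by_cases hvr : v = r
      · exact hvr ▸ SimpleGraph.Reachable.refl _
      · have h := hg v hvr
        have hvg : H.Adj v (g v) := by
          rw [hH, SimpleGraph.fromRel_adj]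
          exact ⟨h.1.ne, Or.inl (Function.update_of_ne hvr _ _)⟩
        exact hvg.reachable.trans (ih _ (hv ▸ h.2) _ rfl)
  have hconn : H.Connected :=
    (SimpleGraph.connected_iff_exists_forall_reachable H).2 ⟨r, fun v => (hreach _ v rfl).symm⟩
  exact le_antisymm ((SimpleGraph.isTree_iff_minimal_connected.1 hτ).2 hconn hle) hle

/-- There are at most `k ^ ℓ * (k + ℓ) ^ (k - 1)` trees on `Fin k ⊕ Fin ℓ` in which the second part
is independent: root at a vertex of the first part and choose all parents. -/
theorem card_isTree_independent_le (k ℓ : ℕ) (hk : 1 ≤ k) :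
    Nat.card {τ : SimpleGraph (Fin k ⊕ Fin ℓ) //
      τ.IsTree ∧ ∀ i j : Fin ℓ, ¬ τ.Adj (Sum.inr i) (Sum.inr j)} ≤
        k ^ ℓ * (k + ℓ) ^ (k - 1) := by
  classical
  let z : Fin k := ⟨0, hk⟩
  let parent (p : (Fin ℓ → Fin k) × ({i : Fin k // i ≠ z} → Fin k ⊕ Fin ℓ)) :
      Fin k ⊕ Fin ℓ → Fin k ⊕ Fin ℓ :=
    Sum.elim (fun i => if h : i ≠ z then p.2 ⟨i, h⟩ else Sum.inl z) (fun j => Sum.inl (p.1 j))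
  have key : ∀ τ : {τ : SimpleGraph (Fin k ⊕ Fin ℓ) //
      τ.IsTree ∧ ∀ i j : Fin ℓ, ¬ τ.Adj (Sum.inr i) (Sum.inr j)},
      ∃ p, τ.1 = SimpleGraph.fromRel (fun u v => parent p u = v) := by
    rintro ⟨τ, hτ, hind⟩
    obtain ⟨f, hfr, hadj, hf⟩ := hτ.exists_parent (Sum.inl z)
    have hleft : ∀ j : Fin ℓ, ∃ i : Fin k, f (Sum.inr j) = Sum.inl i := by
      intro j
      have h := hadj (Sum.inr j) (by simp)
      cases hc : f (Sum.inr j) with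
      | inl i => exact ⟨i, rfl⟩
      | inr i => exact absurd (hc ▸ h) (hind j i)
    choose g hg using hleft
    refine ⟨(g, fun i => f (Sum.inl i)), ?_⟩
    have hpar : parent (g, fun i => f (Sum.inl i)) = f := by
      funext v
      rcases v with i | j
      · by_cases hi : i = z
        · simp [parent, hi, hfr]
        · simp [parent, hi]
      · simp [parent, hg]
    rw [hpar]
    exact hf
  choose code hcode using key
  have hinj : Function.Injective code := fun a b hab =>
    Subtype.ext (by rw [hcode a, hcode b, hab])
  calc _ ≤ Nat.card ((Fin ℓ → Fin k) × ({i : Fin k // i ≠ z} → Fin k ⊕ Fin ℓ)) :=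
        Nat.card_le_card_of_injective code hinj
    _ = k ^ ℓ * (k + ℓ) ^ (k - 1) := by
        simp [Nat.card_eq_fintype_card, Fintype.card_subtype_compl]

/-- For `k ≥ 1` and `ℓ ≤ 4k + 1`, the number of trees on the labeled vertex set
`𝒮 ∪ 𝒞` (with `|𝒮| = k`, `|𝒞| = ℓ`) in which every node of `𝒮` has degree at most 5 and
no two nodes of `𝒞` are adjacent is at most `(5k + 1)^(5k - 1)`. -/
theorem stmt9 (k ℓ : ℕ) (hk : 1 ≤ k) (hℓ : ℓ ≤ 4 * k + 1) :
    Nat.card {τ : SimpleGraph (Fin k ⊕ Fin ℓ) //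
        τ.IsTree ∧ (∀ i : Fin k, (τ.neighborSet (Sum.inl i)).ncard ≤ 5) ∧
        ∀ i j : Fin ℓ, ¬ τ.Adj (Sum.inr i) (Sum.inr j)} ≤ (5 * k + 1) ^ (5 * k - 1) := by
  have hpow : k ^ (4 * k + 1) ≤ (5 * k + 1) ^ (4 * k) :=
    calc k ^ (4 * k + 1) = k ^ (4 * k) * k := pow_succ _ _
      _ ≤ k ^ (4 * k) * 5 ^ (4 * k) := by
          gcongr
          exact (Nat.lt_pow_self (by norm_num)).le.trans
            (Nat.pow_le_pow_right (by norm_num) (by omega))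
      _ = (5 * k) ^ (4 * k) := by rw [← mul_pow, mul_comm]
      _ ≤ (5 * k + 1) ^ (4 * k) := by
          gcongr
          omega
  refine (Nat.card_le_card_of_injective (β := {τ : SimpleGraph (Fin k ⊕ Fin ℓ) //
      τ.IsTree ∧ ∀ i j : Fin ℓ, ¬ τ.Adj (Sum.inr i) (Sum.inr j)})
    (Subtype.map id fun _ h => ⟨h.1, h.2.2⟩)
    (Subtype.map_injective _ Function.injective_id)).trans ?_
  calc _ ≤ k ^ ℓ * (k + ℓ) ^ (k - 1) := card_isTree_independent_le k ℓ hk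
    _ ≤ k ^ (4 * k + 1) * (5 * k + 1) ^ (k - 1) :=
        Nat.mul_le_mul (Nat.pow_le_pow_right hk hℓ) (Nat.pow_le_pow_left (by omega) _)
    _ ≤ (5 * k + 1) ^ (4 * k) * (5 * k + 1) ^ (k - 1) := Nat.mul_le_mul_right _ hpow
    _ = (5 * k + 1) ^ (5 * k - 1) := by
        rw [← pow_add]
        congr 1
        omega
end

section
/- Let h ≥ 1, let q, e, f ∈ ℝ² with ‖e‖ = ‖f‖ = 1, and let g be an (h−1)-square root function. Define Δ̃(x) = x² + ((e·f)² − 1)·g(x)² + 2((q·f) − (e·q)(e·f))·g(x) + (e·q)² − ‖q‖², and define t₋(x) = (e·f)·g(x) − (e·q) − √(Δ̃(x)) and t₊(x) = (e·f)·g(x) − (e·q) + √(Δ̃(x)) on the set of x in the domain of g with Δ̃(x) ≥ 0. Then: (a) for every such x, the set of real numbers t satisfying ‖q + t·e − g(x)·f‖² = x² is exactly {t₋(x), t₊(x)}; and (b) both t₋ and t₊ are h-square root functions. -/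
open scoped RealInnerProductSpace

noncomputable section

/-- `IsHSqrtFun h f D` : `f`, as a partial real function with domain `D`, is an
`h`-square root function.  A `0`-square root function is an affine function (with domain all
of `ℝ`); for `h ≥ 1`, an `h`-square root function is one of the form
`x ↦ a₁·g(x) + a₂ + a₃·√(ε·x² + a₄·g(x)² + a₅·g(x) + a₆)` with `ε ∈ {1, -1}` and `g` an
`(h-1)`-square root function, its domain consisting of the points of the domain of `g` where
the radicand is nonnegative. -/
inductive IsHSqrtFun : ℕ → (ℝ → ℝ) → Set ℝ → Prop
  | zero (c d : ℝ) : IsHSqrtFun 0 (fun x => c * x + d) Set.univ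
  | succ (h : ℕ) (a₁ a₂ a₃ a₄ a₅ a₆ ε : ℝ) (hε : ε = 1 ∨ ε = -1)
      (g : ℝ → ℝ) (Dg : Set ℝ) (hg : IsHSqrtFun h g Dg) :
      IsHSqrtFun (h + 1)
        (fun x => a₁ * g x + a₂ + a₃ * Real.sqrt (ε * x ^ 2 + a₄ * g x ^ 2 + a₅ * g x + a₆))
        {x ∈ Dg | 0 ≤ ε * x ^ 2 + a₄ * g x ^ 2 + a₅ * g x + a₆}

/-- Completing the square in `‖q + t • e - y • f‖ ^ 2` for unit vectors `e` and `f`. -/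
theorem norm_add_smul_sub_smul_sq {E : Type*} [NormedAddCommGroup E] [InnerProductSpace ℝ E]
    {e f : E} (he : ‖e‖ = 1) (hf : ‖f‖ = 1) (q : E) (t y : ℝ) :
    ‖q + t • e - y • f‖ ^ 2 = (t - (⟪e, f⟫ * y - ⟪e, q⟫)) ^ 2
      - ((⟪e, f⟫ ^ 2 - 1) * y ^ 2 + 2 * (⟪q, f⟫ - ⟪e, q⟫ * ⟪e, f⟫) * y
        + (⟪e, q⟫ ^ 2 - ‖q‖ ^ 2)) := by
  rw [norm_sub_sq_real, norm_add_sq_real]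
  simp only [inner_add_left, real_inner_smul_left, real_inner_smul_right, norm_smul, mul_pow,
    he, hf, Real.norm_eq_abs, sq_abs, real_inner_comm e q]
  ring

/-- Solving `‖q + t·e − g(x)·f‖² = x²` for `t`:  the solutions are
`t∓(x) = (e·f)·g(x) − (e·q) ∓ √(Δ̃(x))`, and both are `h`-square root functions. -/
theorem stmt10 (h : ℕ) (hh : 1 ≤ h) (q e f : Pl) (he : ‖e‖ = 1) (hf : ‖f‖ = 1)
    (g : ℝ → ℝ) (Dg : Set ℝ) (hg : IsHSqrtFun (h - 1) g Dg)
    (Δ : ℝ → ℝ)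
    (hΔ : Δ = fun x => x ^ 2 + (⟪e, f⟫ ^ 2 - 1) * g x ^ 2
        + 2 * (⟪q, f⟫ - ⟪e, q⟫ * ⟪e, f⟫) * g x + (⟪e, q⟫ ^ 2 - ‖q‖ ^ 2))
    (tm tp : ℝ → ℝ)
    (htm : tm = fun x => ⟪e, f⟫ * g x - ⟪e, q⟫ - Real.sqrt (Δ x))
    (htp : tp = fun x => ⟪e, f⟫ * g x - ⟪e, q⟫ + Real.sqrt (Δ x)) :
    (∀ x ∈ Dg, 0 ≤ Δ x → ∀ t : ℝ,
        ‖q + t • e - g x • f‖ ^ 2 = x ^ 2 ↔ (t = tm x ∨ t = tp x)) ∧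
    IsHSqrtFun h tm {x ∈ Dg | 0 ≤ Δ x} ∧ IsHSqrtFun h tp {x ∈ Dg | 0 ≤ Δ x} := by
  subst hΔ htm htp
  obtain ⟨n, rfl⟩ : ∃ n, h = n + 1 := ⟨h - 1, by omega⟩
  rw [Nat.add_sub_cancel] at hg
  have key := fun s : ℝ => IsHSqrtFun.succ n ⟪e, f⟫ (-⟪e, q⟫) s (⟪e, f⟫ ^ 2 - 1)
    (2 * (⟪q, f⟫ - ⟪e, q⟫ * ⟪e, f⟫)) (⟪e, q⟫ ^ 2 - ‖q‖ ^ 2) 1 (Or.inl rfl) g Dg hg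
  simp only [one_mul, ← sub_eq_add_neg] at key
  refine ⟨fun x _ hx t => ?_, by simpa only [neg_one_mul, ← sub_eq_add_neg] using key (-1),
    by simpa only [one_mul] using key 1⟩
  have hsq := Real.sq_sqrt hx
  simp only at hsq ⊢
  rw [norm_add_smul_sub_smul_sq he hf, sub_eq_iff_eq_add, ← add_assoc, ← add_assoc]
  conv_lhs => rw [← hsq]
  rw [sq_eq_sq_iff_eq_or_eq_neg, or_comm, sub_eq_iff_eq_add', sub_eq_iff_eq_add',
    ← sub_eq_add_neg]

end
end

section
/- Let s be a closed line segment in ℝ², let δ > 0, and let σ_1,…,σ_N be pairwise disjoint closed segments (possibly degenerate to points) all contained in a common line L, indexed in order along L (for each j, σ_{j+1} lies strictly after σ_j along a fixed direction of L). For j = 1,…,N let η_j = (σ_j ⊕ D(0,δ)) ∩ s, where ⊕ denotes Minkowski sum and D(0,δ) is the closed disk of radius δ centered at the origin. If η_i ≠ ∅ and η_j ≠ ∅ for some 1 ≤ i < j ≤ N, then η_m ≠ ∅ for every m with i ≤ m ≤ j. -/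
open scoped Pointwise

noncomputable section

theorem upper_lt_lower_of_lt {N : ℕ} {α β : ℕ → ℝ} (hab : ∀ j, j < N → α j ≤ β j)
    (hord : ∀ j, j + 1 < N → β j < α (j + 1)) {i j : ℕ} (hij : i < j) (hj : j < N) :
    β i < α j := by
  induction j, hij using Nat.le_induction with
  | base => exact hord i hj
  | succ k _ ih =>
    exact ((ih (by omega)).trans_le (hab k (by omega))).trans (hord k hj)

theorem exists_mem_Icc_of_mem_segment_add_smul {E : Type*} [AddCommGroup E] [Module ℝ E]
    {p e x : E} {a b : ℝ} (hab : a ≤ b) (hx : x ∈ segment ℝ (p + a • e) (p + b • e)) :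
    ∃ t ∈ Set.Icc a b, x = p + t • e := by
  obtain ⟨u, v, hu, hv, huv, rfl⟩ := hx
  obtain rfl : u = 1 - v := by linarith
  refine ⟨(1 - v) * a + v * b, ⟨?_, ?_⟩, ?_⟩
  · nlinarith
  · nlinarith
  · module

/-- If `s` is convex and meets the closed `δ`-balls around two points of a line, then it meets
the closed `δ`-ball around every point of the line between them. -/
theorem Convex.exists_add_mem_of_line {E : Type*} [SeminormedAddCommGroup E] [NormedSpace ℝ E]
    {s : Set E} (hs : Convex ℝ s) {δ : ℝ} {p e u v : E} {a b t : ℝ} (ht : t ∈ Set.Icc a b)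
    (hu : u ∈ Metric.closedBall (0 : E) δ) (hv : v ∈ Metric.closedBall (0 : E) δ)
    (hus : p + a • e + u ∈ s) (hvs : p + b • e + v ∈ s) :
    ∃ w ∈ Metric.closedBall (0 : E) δ, p + t • e + w ∈ s := by
  rw [← segment_eq_Icc (ht.1.trans ht.2)] at ht
  obtain ⟨c, d, hc, hd, hcd, rfl⟩ := ht
  refine ⟨c • u + d • v, convex_closedBall 0 δ hu hv hc hd hcd, ?_⟩
  convert hs hus hvs hc hd hcd using 1
  obtain rfl : c = 1 - d := by linarith
  simp only [smul_eq_mul]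
  module

/-- Let `σ_0, …, σ_{N-1}` be pairwise disjoint closed segments on a common line `L`
(parameterized by a point `p` and a unit direction `e`), indexed in order along `L`
(`σ_{j+1}` lies strictly after `σ_j`), let `s` be a closed segment and `δ > 0`, and let
`η_j = (σ_j ⊕ D(0,δ)) ∩ s`.  If `η_i ≠ ∅` and `η_j ≠ ∅` for some `i < j`, then `η_m ≠ ∅`
for every `i ≤ m ≤ j`. -/
theorem stmt12 (N : ℕ) (cS dS : Pl) (sSeg : Set Pl) (hs : sSeg = segment ℝ cS dS)
    (δ : ℝ) (hδ : 0 < δ)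
    (p e : Pl) (he : ‖e‖ = 1)
    (α β : ℕ → ℝ)
    (hab : ∀ j, j < N → α j ≤ β j)
    (hord : ∀ j, j + 1 < N → β j < α (j + 1))
    (η : ℕ → Set Pl)
    (hη : ∀ j, j < N →
      η j = (segment ℝ (p + α j • e) (p + β j • e) + Metric.closedBall (0 : Pl) δ) ∩ sSeg)
    (i j m : ℕ) (hi : i ≤ m) (hm : m ≤ j) (hj : j < N)
    (hηi : (η i).Nonempty) (hηj : (η j).Nonempty) :
    (η m).Nonempty := by
  subst hs
  rcases hi.eq_or_lt with rfl | him
  · exact hηi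
  rcases hm.eq_or_lt with rfl | hmj
  · exact hηj
  have hmN : m < N := hmj.trans hj
  have hiN : i < N := him.trans hmN
  rw [hη i hiN] at hηi
  rw [hη j hj] at hηj
  rw [hη m hmN]
  obtain ⟨_, ⟨x, hx, u, hu, rfl⟩, hxs⟩ := hηi
  obtain ⟨_, ⟨y, hy, v, hv, rfl⟩, hys⟩ := hηj
  obtain ⟨a, ha, rfl⟩ := exists_mem_Icc_of_mem_segment_add_smul (hab i hiN) hx
  obtain ⟨b, hb, rfl⟩ := exists_mem_Icc_of_mem_segment_add_smul (hab j hj) hy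
  have hat : a ≤ α m := ha.2.trans (upper_lt_lower_of_lt hab hord him hmN).le
  have htb : α m ≤ b :=
    ((hab m hmN).trans (upper_lt_lower_of_lt hab hord hmj hj).le).trans hb.1
  obtain ⟨w, hw, hws⟩ :=
    (convex_segment cS dS).exists_add_mem_of_line ⟨hat, htb⟩ hu hv hxs hys
  exact ⟨_, Set.add_mem_add (left_mem_segment ℝ _ _) hw, hws⟩

end
end

section
/- Let Q be a nonempty finite set of points in ℝ² and let δ ≥ 0. The graph G_δ(Q) is connected if and only if the union ⋃_{p ∈ Q} D(p, δ/2) of the closed disks of radius δ/2 centered at the points of Q is a connected subset of ℝ². -/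
noncomputable section

/-- A finite family of closed connected sets has connected union if and only if its
intersection graph is connected. -/
theorem connected_fromRel_inter_nonempty_iff {X ι : Type*} [TopologicalSpace X] [Finite ι]
    {s : ι → Set X} (hcl : ∀ i, IsClosed (s i)) (hs : ∀ i, IsConnected (s i)) :
    (SimpleGraph.fromRel fun i j => (s i ∩ s j).Nonempty).Connected ↔
      IsConnected (⋃ i, s i) := by
  set G := SimpleGraph.fromRel fun i j => (s i ∩ s j).Nonempty
  constructor
  · intro h
    have := h.nonempty
    refine IsConnected.iUnion_of_reflTransGen hs fun i j => ?_
    refine Relation.ReflTransGen.mono (fun a b hab => ?_) i j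
      ((SimpleGraph.reachable_iff_reflTransGen i j).1 (h.preconnected i j))
    rcases ((SimpleGraph.fromRel_adj _ a b).1 hab).2 with h' | h'
    exacts [h', Set.inter_comm (s b) (s a) ▸ h']
  · rintro ⟨⟨x, hx⟩, hpre⟩
    obtain ⟨i₀, -⟩ := Set.mem_iUnion.1 hx
    have : Nonempty ι := ⟨i₀⟩
    refine ⟨fun v w => ?_⟩
    by_contra hvw
    obtain ⟨a, ha⟩ := (hs v).nonempty
    obtain ⟨b, hb⟩ := (hs w).nonempty
    have hclosed (p : ι → Prop) : IsClosed (⋃ i ∈ {i | p i}, s i) :=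
      (Set.toFinite _).isClosed_biUnion fun i _ => hcl i
    obtain ⟨y, -, hy₁, hy₂⟩ := isPreconnected_closed_iff.1 hpre _ _
      (hclosed (G.Reachable v)) (hclosed fun i => ¬ G.Reachable v i)
      (fun z hz => by
        obtain ⟨i, hi⟩ := Set.mem_iUnion.1 hz
        by_cases hr : G.Reachable v i
        · exact Or.inl (Set.mem_biUnion hr hi)
        · exact Or.inr (Set.mem_biUnion hr hi))
      ⟨a, Set.mem_iUnion_of_mem v ha, Set.mem_biUnion (SimpleGraph.Reachable.refl v) ha⟩
      ⟨b, Set.mem_iUnion_of_mem w hb, Set.mem_biUnion hvw hb⟩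
    obtain ⟨i, hi, hyi⟩ := Set.mem_iUnion₂.1 hy₁
    obtain ⟨j, hj, hyj⟩ := Set.mem_iUnion₂.1 hy₂
    have hij : i ≠ j := by
      rintro rfl
      exact hj hi
    have hadj : G.Adj i j := (SimpleGraph.fromRel_adj _ i j).2 ⟨hij, Or.inl ⟨y, hyi, hyj⟩⟩
    exact hj (SimpleGraph.Reachable.trans hi hadj.reachable)

/-- Two closed balls of radius `δ / 2` meet if and only if their centers are at distance at
most `δ`. -/
theorem closedBall_half_inter_nonempty_iff {E : Type*} [SeminormedAddCommGroup E]
    [NormedSpace ℝ E] {δ : ℝ} (hδ : 0 ≤ δ) (x y : E) :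
    (Metric.closedBall x (δ / 2) ∩ Metric.closedBall y (δ / 2)).Nonempty ↔ dist x y ≤ δ := by
  rw [← Set.not_disjoint_iff_nonempty_inter,
    disjoint_closedBall_closedBall_iff (by positivity) (by positivity), add_halves, not_lt]

/-- For a nonempty finite point set `Q ⊆ ℝ²` and `δ ≥ 0`, the graph `G_δ(Q)` (two distinct
points adjacent iff at distance at most `δ`) is connected iff the union of the closed disks
of radius `δ/2` centered at the points of `Q` is a connected subset of the plane. -/
theorem stmt14 (Q : Finset Pl) (hQ : Q.Nonempty) (δ : ℝ) (hδ : 0 ≤ δ) :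
    (SimpleGraph.fromRel fun x y : {x // x ∈ Q} => dist (x : Pl) (y : Pl) ≤ δ).Connected ↔
      IsConnected (⋃ p ∈ Q, Metric.closedBall p (δ / 2)) := by
  have h := connected_fromRel_inter_nonempty_iff
    (s := fun p : {x // x ∈ Q} => Metric.closedBall (p : Pl) (δ / 2))
    (fun _ => Metric.isClosed_closedBall) fun p =>
      (convex_closedBall (p : Pl) (δ / 2)).isConnected
        (Metric.nonempty_closedBall.2 (by positivity))
  simp only [closedBall_half_inter_nonempty_iff hδ] at h
  rw [h, Set.iUnion_subtype]

end
end

section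
/- Let I_1,…,I_N be pairwise disjoint nonempty compact intervals in ℝ and let J_1,…,J_{N'} be pairwise disjoint nonempty compact intervals in ℝ. Then the number of pairs (i, j) with 1 ≤ i ≤ N, 1 ≤ j ≤ N', and I_i ∩ J_j ≠ ∅ is at most N + N'. -/
/-- Given pairwise disjoint nonempty compact intervals `I_1,…,I_N` and pairwise disjoint
nonempty compact intervals `J_1,…,J_{N'}` in `ℝ`, the number of pairs `(i, j)` with
`I_i ∩ J_j ≠ ∅` is at most `N + N'`. -/
theorem stmt16 (N N' : ℕ) (a b : Fin N → ℝ) (c d : Fin N' → ℝ)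
    (hab : ∀ i, a i ≤ b i) (hcd : ∀ j, c j ≤ d j)
    (hI : ∀ i i', i ≠ i' → Disjoint (Set.Icc (a i) (b i)) (Set.Icc (a i') (b i')))
    (hJ : ∀ j j', j ≠ j' → Disjoint (Set.Icc (c j) (d j)) (Set.Icc (c j') (d j'))) :
    Set.ncard {q : Fin N × Fin N' |
        (Set.Icc (a q.1) (b q.1) ∩ Set.Icc (c q.2) (d q.2)).Nonempty} ≤ N + N' := by
  classical
  -- The larger of the two left endpoints lies in both intervals and determines the pair.
  let f : Fin N × Fin N' → Fin N ⊕ Fin N' := fun q =>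
    if c q.2 ≤ a q.1 then Sum.inl q.1 else Sum.inr q.2
  have hcard : (Set.univ : Set (Fin N ⊕ Fin N')).ncard = N + N' := by
    simp [Set.ncard_univ]
  rw [← hcard]
  refine Set.ncard_le_ncard_of_injOn f (fun _ _ => Set.mem_univ _) ?_ Set.finite_univ
  rintro ⟨i, j⟩ ⟨x, ⟨hx₁, hx₂⟩, hx₃, hx₄⟩ ⟨i', j'⟩ ⟨y, ⟨hy₁, hy₂⟩, hy₃, hy₄⟩ h
  dsimp only [f] at *
  split_ifs at h with h₁ h₂ h₂
  · obtain rfl := Sum.inl.inj h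
    by_contra hne
    have hj : j ≠ j' := fun e => hne (by rw [e])
    exact Set.disjoint_left.mp (hJ j j' hj) ⟨h₁, hx₁.trans hx₄⟩ ⟨h₂, hy₁.trans hy₄⟩
  · obtain rfl := Sum.inr.inj h
    by_contra hne
    have hi : i ≠ i' := fun e => hne (by rw [e])
    exact Set.disjoint_left.mp (hI i i' hi) ⟨(not_le.mp h₁).le, hx₃.trans hx₂⟩
      ⟨(not_le.mp h₂).le, hy₃.trans hy₂⟩
end

section
/- Let s_1,…,s_k (k ≥ 1) be closed line segments in ℝ² and let P = {p_{k+1},…,p_n} be a (possibly empty) finite set of points in ℝ². Let δ* = inf{δ ≥ 0 : there exist points q_i ∈ s_i (i = 1,…,k) such that G_δ({q_1,…,q_k} ∪ P) is connected}. Then the infimum is attained: there exist points p_i ∈ s_i (i = 1,…,k) such that G_{δ*}({p_1,…,p_k} ∪ P) is connected. -/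
noncomputable section

/-- The graph `G_δ(Q)`: vertices are the points of `Q`, two distinct points being adjacent
iff their Euclidean distance is at most `δ`; `ConnAt Q δ` says this graph is connected. -/
def ConnAt (Q : Set Pl) (δ : ℝ) : Prop :=
  (SimpleGraph.fromRel fun x y : Q => dist (x : Pl) (y : Pl) ≤ δ).Connected

/-- For `δ ≥ 0`, the graph on the points of a finite family is connected iff every cut of the
index set is crossed by a pair of points at distance at most `δ`. -/
theorem connAt_range_iff_forall_cut {ι : Type*} [Nonempty ι] (f : ι → Pl) {δ : ℝ} (hδ : 0 ≤ δ) :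
    ConnAt (Set.range f) δ ↔ ∀ A : Set ι, A.Nonempty → Aᶜ.Nonempty →
      ∃ i : A, ∃ j : (Aᶜ : Set ι), dist (f i) (f j) ≤ δ := by
  constructor
  · rintro h A ⟨i, hi⟩ ⟨j, hj⟩
    by_contra! hcut
    have himage : ∀ x : Set.range f,
        (SimpleGraph.fromRel fun x y : Set.range f => dist (x : Pl) (y : Pl) ≤ δ).Reachable
          ⟨f i, i, rfl⟩ x → ∃ a ∈ A, f a = x := by
      intro x hx
      rw [SimpleGraph.reachable_iff_reflTransGen] at hx
      induction hx with
      | refl => exact ⟨i, hi, rfl⟩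
      | @tail y z _ hyz ih =>
        obtain ⟨a, ha, hay⟩ := ih
        obtain ⟨_, b, rfl⟩ := z
        refine ⟨b, ?_, rfl⟩
        by_contra hb
        have hlt : δ < dist (f a) (f b) := hcut ⟨a, ha⟩ ⟨b, hb⟩
        rw [hay] at hlt
        rcases (SimpleGraph.fromRel_adj _ _ _).1 hyz with ⟨_, h1 | h1⟩
        · exact absurd h1 (not_le.2 hlt)
        · rw [dist_comm] at h1
          exact absurd h1 (not_le.2 hlt)
    obtain ⟨a, ha, haj⟩ := himage ⟨f j, j, rfl⟩ (h.preconnected _ _)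
    have hlt : δ < dist (f a) (f j) := hcut ⟨a, ha⟩ ⟨j, hj⟩
    rw [haj, dist_self] at hlt
    exact absurd hδ (not_le.2 hlt)
  · intro h
    refine @SimpleGraph.Connected.mk _ _ ?_ (Set.range_nonempty f).to_subtype
    rintro ⟨_, i, rfl⟩ ⟨_, j, rfl⟩
    by_contra hij
    obtain ⟨⟨a, ha⟩, ⟨b, hb⟩, hab⟩ := h
      {a | (SimpleGraph.fromRel fun x y : Set.range f => dist (x : Pl) (y : Pl) ≤ δ).Reachable
        ⟨f i, i, rfl⟩ ⟨f a, a, rfl⟩} ⟨i, SimpleGraph.Reachable.refl _⟩ ⟨j, hij⟩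
    apply hb
    by_cases hEq : f a = f b
    · simpa only [Set.mem_ofPred_eq, hEq] using ha
    · refine SimpleGraph.Reachable.trans ha (SimpleGraph.Adj.reachable ?_)
      exact (SimpleGraph.fromRel_adj _ _ _).2
        ⟨fun hh => hEq (congrArg Subtype.val hh), Or.inl hab⟩

/-- If finitely many points depend continuously on a parameter in a nonempty compact space, then
the least nonnegative scale at which their graph is connected for some parameter is attained. -/
theorem sInf_mem_setOf_exists_connAt {X ι : Type*} [TopologicalSpace X] [CompactSpace X]
    [Nonempty X] [Finite ι] [Nonempty ι] (f : X → ι → Pl) (hf : Continuous f) :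
    sInf {δ : ℝ | 0 ≤ δ ∧ ∃ x, ConnAt (Set.range (f x)) δ} ∈
      {δ : ℝ | 0 ≤ δ ∧ ∃ x, ConnAt (Set.range (f x)) δ} := by
  have hcut : {δ : ℝ | 0 ≤ δ ∧ ∃ x, ConnAt (Set.range (f x)) δ} =
      Prod.snd '' {p : X × ℝ | 0 ≤ p.2 ∧ ∀ A : Set ι, A.Nonempty → Aᶜ.Nonempty →
        ∃ i : A, ∃ j : (Aᶜ : Set ι), dist (f p.1 i) (f p.1 j) ≤ p.2} := by
    ext δ
    constructor
    · rintro ⟨hδ, x, hx⟩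
      exact ⟨(x, δ), ⟨hδ, (connAt_range_iff_forall_cut _ hδ).1 hx⟩, rfl⟩
    · rintro ⟨⟨x, _⟩, ⟨hδ, hx⟩, rfl⟩
      exact ⟨hδ, x, (connAt_range_iff_forall_cut _ hδ).2 hx⟩
  refine IsClosed.csInf_mem ?_ ?_ ⟨0, fun δ hδ => hδ.1⟩
  · rw [hcut]
    apply isClosedMap_snd_of_compactSpace
    simp only [Set.ofPred_and, Set.ofPred_forall, Set.ofPred_exists]
    refine (isClosed_le continuous_const continuous_snd).inter ?_
    refine isClosed_iInter fun A => isClosed_iInter fun _ => isClosed_iInter fun _ =>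
      isClosed_iUnion_of_finite fun i => isClosed_iUnion_of_finite fun j => ?_
    exact isClosed_le (by fun_prop) continuous_snd
  · obtain ⟨x⟩ := ‹Nonempty X›
    obtain ⟨M, hM⟩ := (Set.finite_range fun p : ι × ι => dist (f x p.1) (f x p.2)).bddAbove
    refine ⟨max 0 M, le_max_left _ _, x,
      (connAt_range_iff_forall_cut _ (le_max_left _ _)).2 ?_⟩
    rintro A ⟨i, hi⟩ ⟨j, hj⟩
    exact ⟨⟨i, hi⟩, ⟨j, hj⟩, (hM ⟨(i, j), rfl⟩).trans (le_max_right _ _)⟩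

/-- The infimum `δ* = inf {δ ≥ 0 : ∃ qᵢ ∈ sᵢ with G_δ({q₁,…,q_k} ∪ P) connected}` is
attained: there are points `pᵢ ∈ sᵢ` with `G_{δ*}({p₁,…,p_k} ∪ P)` connected. -/
theorem stmt17 (k : ℕ) (hk : 1 ≤ k) (s : Fin k → Set Pl)
    (hseg : ∀ i, ∃ a b : Pl, s i = segment ℝ a b)
    (P : Finset Pl)
    (δstar : ℝ)
    (hδstar : δstar = sInf {δ : ℝ | 0 ≤ δ ∧ ∃ q : Fin k → Pl,
        (∀ i, q i ∈ s i) ∧ ConnAt (Set.range q ∪ ↑P) δ}) :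
    ∃ p : Fin k → Pl, (∀ i, p i ∈ s i) ∧ ConnAt (Set.range p ∪ ↑P) δstar := by
  have hcompact : ∀ i, IsCompact (s i) := fun i => by
    obtain ⟨a, b, h⟩ := hseg i
    rw [h, segment_eq_image_lineMap]
    exact isCompact_Icc.image AffineMap.lineMap_continuous
  have hnonempty : ∀ i, (s i).Nonempty := fun i => by
    obtain ⟨a, b, h⟩ := hseg i
    exact ⟨a, h ▸ left_mem_segment ℝ a b⟩
  have : ∀ i, CompactSpace (s i) := fun i => isCompact_iff_compactSpace.1 (hcompact i)
  have : ∀ i, Nonempty (s i) := fun i => (hnonempty i).to_subtype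
  have : Nonempty (Fin k ⊕ P) := ⟨Sum.inl ⟨0, hk⟩⟩
  have hf : Continuous fun x : ∀ i, s i =>
      (Sum.elim (fun i => (x i : Pl)) (fun p : P => (p : Pl)) : Fin k ⊕ P → Pl) := by
    refine continuous_pi ?_
    rintro (i | p)
    · exact continuous_subtype_val.comp (continuous_apply i)
    · exact continuous_const
  have hrange : ∀ q : Fin k → Pl,
      Set.range (Sum.elim q (fun p : P => (p : Pl))) = Set.range q ∪ ↑P := fun q => by
    rw [Set.Sum.elim_range]
    congr 1
    exact Subtype.range_coe
  have hmem := sInf_mem_setOf_exists_connAt _ hf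
  have hset : {δ : ℝ | 0 ≤ δ ∧ ∃ q : Fin k → Pl,
      (∀ i, q i ∈ s i) ∧ ConnAt (Set.range q ∪ ↑P) δ} =
      {δ : ℝ | 0 ≤ δ ∧ ∃ x : ∀ i, s i, ConnAt (Set.range
        (Sum.elim (fun i => (x i : Pl)) (fun p : P => (p : Pl)) : Fin k ⊕ P → Pl)) δ} := by
    ext δ
    simp only [Set.mem_ofPred_eq, hrange]
    refine and_congr_right fun _ => ⟨?_, ?_⟩
    · rintro ⟨q, hq, h⟩
      exact ⟨fun i => ⟨q i, hq i⟩, h⟩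
    · rintro ⟨x, h⟩
      exact ⟨_, fun i => (x i).2, h⟩
  rw [← hset, ← hδstar] at hmem
  exact hmem.2

end
end
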